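/- Let ψ: ℕ → (0,∞) be a non-increasing approximation function, and fix N ∈ ℕ^d and v ∈ ℤ^d, where d = m + n. If ∑_{k=1}^∞ ψ(k) = ∞, then for Lebesgue-almost every real m×n matrix θ there are infinitely many pairs (p,q) ∈ ℤ^m × ℤ^n satisfying ‖θq + p‖^m ≤ ψ(‖q‖^n) together with the congruence conditions p_j ≡ v_j (mod N_j) for every 1 ≤ j ≤ m and q_j ≡ v_{m+j} (mod N_{m+j}) for every 1 ≤ j ≤ n. -/

import Mathlib

open MeasureTheory

/-- The character `ξ ↦ ∑ j, q j • ξ j` of the torus with nonnegative frequency vector `q`. -/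
def torusForm {ι : Type*} [Fintype ι] (q : ι → ℕ) : (ι → UnitAddCircle) →+ UnitAddCircle where
  toFun ξ := ∑ j, q j • ξ j
  map_zero' := by simp
  map_add' ξ η := by simp [Finset.sum_add_distrib]

theorem torusForm_apply {ι : Type*} [Fintype ι] (q : ι → ℕ) (ξ : ι → UnitAddCircle) :
    torusForm q ξ = ∑ j, q j • ξ j := rfl

theorem torusForm_smul {ι : Type*} [Fintype ι] (a : ℕ) (q : ι → ℕ) (ξ : ι → UnitAddCircle) :
    torusForm (fun j => a * q j) ξ = a • torusForm q ξ := by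
  simp [torusForm_apply, Finset.smul_sum, mul_smul]

theorem continuous_torusForm {ι : Type*} [Fintype ι] (q : ι → ℕ) : Continuous (torusForm q) := by
  change Continuous fun ξ : ι → UnitAddCircle => ∑ j, q j • ξ j
  fun_prop

theorem torusForm_surjective {ι : Type*} [Fintype ι] {q : ι → ℕ} {i : ι} (hi : q i ≠ 0) :
    Function.Surjective (torusForm q) := by
  classical
  intro y
  obtain ⟨y, rfl⟩ := QuotientAddGroup.mk_surjective y
  refine ⟨Pi.single i ((y / q i : ℝ) : UnitAddCircle), ?_⟩
  rw [torusForm_apply, Finset.sum_eq_single i]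
  · rw [Pi.single_eq_same, ← AddCircle.coe_nsmul, nsmul_eq_mul,
      mul_div_cancel₀ _ (Nat.cast_ne_zero.mpr hi)]
  · intro j _ hj
    simp [Pi.single_eq_of_ne hj]
  · simp

theorem torusForm_prod_surjective {ι : Type*} [Fintype ι] {q q' : ι → ℕ} {i j : ι}
    (hij : q i * q' j ≠ q j * q' i) :
    Function.Surjective ((torusForm q).prod (torusForm q')) := by
  classical
  rintro ⟨y, z⟩
  obtain ⟨y, rfl⟩ := QuotientAddGroup.mk_surjective y
  obtain ⟨z, rfl⟩ := QuotientAddGroup.mk_surjective z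
  have hΔ : (q i * q' j - q j * q' i : ℝ) ≠ 0 := by
    rw [sub_ne_zero]; exact_mod_cast hij
  set Δ : ℝ := q i * q' j - q j * q' i with hΔdef
  have key : ∀ (p : ι → ℕ) (s t : ℝ),
      torusForm p (Pi.single i (s : UnitAddCircle) + Pi.single j (t : UnitAddCircle)) =
        ((p i * s + p j * t : ℝ) : UnitAddCircle) := by
    intro p s t
    have single : ∀ (k : ι) (x : ℝ),
        torusForm p (Pi.single k (x : UnitAddCircle)) = ((p k * x : ℝ) : UnitAddCircle) := by
      intro k x
      rw [torusForm_apply, Finset.sum_eq_single k]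
      · rw [Pi.single_eq_same, ← AddCircle.coe_nsmul, nsmul_eq_mul]
      · intro l _ hl
        simp [Pi.single_eq_of_ne hl]
      · simp
    rw [map_add, single, single, ← AddCircle.coe_add]
  refine ⟨Pi.single i (((y * q' j - z * q j) / Δ : ℝ) : UnitAddCircle) +
    Pi.single j (((q i * z - q' i * y) / Δ : ℝ) : UnitAddCircle), ?_⟩
  rw [AddMonoidHom.prod_apply, key, key]
  refine Prod.ext ?_ ?_
  · refine congrArg (fun x : ℝ => (x : UnitAddCircle)) ?_
    rw [mul_div_assoc', mul_div_assoc', ← add_div, div_eq_iff hΔ, hΔdef]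
    ring
  · refine congrArg (fun x : ℝ => (x : UnitAddCircle)) ?_
    rw [mul_div_assoc', mul_div_assoc', ← add_div, div_eq_iff hΔ, hΔdef]
    ring

instance UnitAddCircle.isProbabilityMeasure_volume :
    IsProbabilityMeasure (volume : Measure UnitAddCircle) :=
  ⟨UnitAddCircle.measure_univ⟩

theorem measurePreserving_torusForm {ι : Type*} [Fintype ι] {q : ι → ℕ} {i : ι} (hi : q i ≠ 0) :
    MeasurePreserving (torusForm q) :=
  AddMonoidHom.measurePreserving (continuous_torusForm q) (torusForm_surjective hi)
    (by rw [measure_univ, measure_univ])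

theorem measurePreserving_torusForm_prod {ι : Type*} [Fintype ι] {q q' : ι → ℕ} {i j : ι}
    (hij : q i * q' j ≠ q j * q' i) :
    MeasurePreserving ((torusForm q).prod (torusForm q')) :=
  haveI : (volume : Measure (UnitAddCircle × UnitAddCircle)).IsAddHaarMeasure :=
    inferInstanceAs ((volume : Measure UnitAddCircle).prod volume).IsAddHaarMeasure
  haveI : IsProbabilityMeasure (volume : Measure (UnitAddCircle × UnitAddCircle)) :=
    inferInstanceAs (IsProbabilityMeasure ((volume : Measure UnitAddCircle).prod volume))
  AddMonoidHom.measurePreserving ((continuous_torusForm q).prodMk (continuous_torusForm q'))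
    (torusForm_prod_surjective hij) (by rw [measure_univ, measure_univ])

theorem volume_real_norm_add_le (β : UnitAddCircle) (r : ℝ) (hr : 0 ≤ r) :
    volume.real {y : UnitAddCircle | ‖y + β‖ ≤ r} = min 1 (2 * r) := by
  have : {y : UnitAddCircle | ‖y + β‖ ≤ r} = Metric.closedBall (-β) r := by
    ext y; simp [dist_eq_norm]
  rw [this, measureReal_def, AddCircle.volume_closedBall, ENNReal.toReal_ofReal]
  positivity

theorem isClosed_norm_torusForm_add_le {ι : Type*} [Fintype ι] (q : ι → ℕ) (β : UnitAddCircle)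
    (r : ℝ) : IsClosed {ξ : ι → UnitAddCircle | ‖torusForm q ξ + β‖ ≤ r} :=
  isClosed_le (((continuous_torusForm q).add continuous_const).norm) continuous_const

theorem volume_real_norm_torusForm_add_le {ι : Type*} [Fintype ι] {q : ι → ℕ} {i : ι}
    (hi : q i ≠ 0) (β : UnitAddCircle) (r : ℝ) (hr : 0 ≤ r) :
    volume.real {ξ : ι → UnitAddCircle | ‖torusForm q ξ + β‖ ≤ r} = min 1 (2 * r) := by
  rw [← volume_real_norm_add_le β r hr]
  have hs : MeasurableSet {y : UnitAddCircle | ‖y + β‖ ≤ r} :=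
    (isClosed_le (by fun_prop) (by fun_prop)).measurableSet
  exact (measurePreserving_torusForm hi).measureReal_preimage hs.nullMeasurableSet

theorem volume_real_norm_torusForm_pair_le {ι : Type*} [Fintype ι] {q q' : ι → ℕ} {i j : ι}
    (hij : q i * q' j ≠ q j * q' i) (β β' : UnitAddCircle) {r r' : ℝ} (hr : 0 ≤ r) (hr' : 0 ≤ r') :
    volume.real ({ξ : ι → UnitAddCircle | ‖torusForm q ξ + β‖ ≤ r} ∩
      {ξ | ‖torusForm q' ξ + β'‖ ≤ r'}) ≤ 4 * (r * r') := by
  have hs : ∀ (β : UnitAddCircle) (r : ℝ), MeasurableSet {y : UnitAddCircle | ‖y + β‖ ≤ r} :=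
    fun β r => (isClosed_le (by fun_prop) (by fun_prop)).measurableSet
  have h := (measurePreserving_torusForm_prod hij).measureReal_preimage
    ((hs β r).prod (hs β' r')).nullMeasurableSet
  have e : (torusForm q).prod (torusForm q') ⁻¹' ({y | ‖y + β‖ ≤ r} ×ˢ {y | ‖y + β'‖ ≤ r'}) =
      {ξ : ι → UnitAddCircle | ‖torusForm q ξ + β‖ ≤ r} ∩ {ξ | ‖torusForm q' ξ + β'‖ ≤ r'} := rfl
  rw [← e, h, Measure.volume_eq_prod, measureReal_prod_prod, volume_real_norm_add_le β r hr,
    volume_real_norm_add_le β' r' hr']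
  calc _ ≤ 2 * r * (2 * r') := by gcongr <;> exact min_le_right _ _
    _ = _ := by ring

theorem card_filter_norm_add_mul_div_le {a b : ℕ} (ha : 0 < a) (hab : a.Coprime b)
    (ζ : UnitAddCircle) {r : ℝ} (hr : 0 ≤ r) :
    (((Finset.range a).filter fun j : ℕ =>
      ‖ζ + ((b * j / a : ℝ) : UnitAddCircle)‖ ≤ r).card : ℝ) ≤ 2 * a * r + 1 := by
  obtain ⟨z, rfl⟩ := QuotientAddGroup.mk_surjective ζ
  have ha' : (0 : ℝ) < a := by exact_mod_cast ha
  set lo : ℤ := ⌈-(a * z) - a * r⌉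
  set hi : ℤ := ⌊-(a * z) + a * r⌋
  have hcard : ((Finset.range a).filter fun j : ℕ =>
      ‖(QuotientAddGroup.mk z : UnitAddCircle) + ((b * j / a : ℝ) : UnitAddCircle)‖ ≤ r).card ≤
      (Finset.Icc lo hi).card := by
    refine Finset.card_le_card_of_injOn (fun j => b * j - a * round (z + b * j / a)) ?_ ?_
    · intro j hj
      have hj := (Finset.mem_filter.mp hj).2
      change ‖((z + b * j / a : ℝ) : UnitAddCircle)‖ ≤ r at hj
      rw [UnitAddCircle.norm_eq, abs_le] at hj
      set s := round (z + b * j / a)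
      have e : (a : ℝ) * (z + b * j / a - s) = a * z + (b * j - a * s) := by
        field_simp
        ring
      have h1 : (a : ℝ) * -r ≤ a * z + (b * j - a * s) := e ▸ mul_le_mul_of_nonneg_left hj.1 ha'.le
      have h2 : a * z + (b * j - a * s) ≤ (a : ℝ) * r := e ▸ mul_le_mul_of_nonneg_left hj.2 ha'.le
      simp only [Finset.coe_Icc, Set.mem_Icc]
      refine ⟨Int.ceil_le.mpr ?_, Int.le_floor.mpr ?_⟩ <;> push_cast <;> linarith
    · intro j hj k hk hjk
      have hj := Finset.mem_range.mp (Finset.mem_filter.mp hj).1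
      have hk := Finset.mem_range.mp (Finset.mem_filter.mp hk).1
      have hdvd : (a : ℤ) ∣ b * ((j : ℤ) - k) := by
        refine ⟨round (z + b * j / a) - round (z + b * k / a), ?_⟩
        simp only at hjk
        linarith
      have hdvd' : (a : ℤ) ∣ (j : ℤ) - k :=
        (Nat.isCoprime_iff_coprime.mpr hab).dvd_of_dvd_mul_left hdvd
      have := Int.eq_zero_of_abs_lt_dvd hdvd' (by rw [abs_lt]; constructor <;> omega)
      omega
  have hI : ((Finset.Icc lo hi).card : ℝ) ≤ 2 * a * r + 1 := by
    rw [Int.card_Icc]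
    have h1 : (hi : ℝ) ≤ -(a * z) + a * r := Int.floor_le _
    have h2 : -(a * z) - a * r ≤ (lo : ℝ) := Int.le_ceil _
    have h3 : 0 ≤ a * r := by positivity
    have h4 : ((hi + 1 - lo).toNat : ℝ) = ((max (hi + 1 - lo) 0 : ℤ) : ℝ) := by
      rw [← Int.toNat_eq_max]; rfl
    rw [h4]
    push_cast
    exact max_le (by linarith) (by linarith)
  exact le_trans (by exact_mod_cast hcard) hI

theorem volume_real_nsmul_pair_le {a b : ℕ} (ha : 0 < a) (hab : a.Coprime b) {r r' : ℝ}
    (hr : 0 ≤ r) (hr' : 0 ≤ r') :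
    volume.real {η : UnitAddCircle | ‖a • η‖ ≤ r ∧ ‖b • η‖ ≤ r'} ≤ 2 * r * (2 * r' + 1 / a) := by
  have ha' : (0 : ℝ) < a := by exact_mod_cast ha
  let A : Set UnitAddCircle := {η | ‖a • η‖ ≤ r}
  let D : UnitAddCircle → Set UnitAddCircle := fun τ => {η | ‖a • η‖ ≤ r ∧ ‖b • η + τ‖ ≤ r'}
  have hA : MeasurableSet A := (isClosed_le (by fun_prop) (by fun_prop)).measurableSet
  have hD : ∀ τ, MeasurableSet (D τ) := fun τ =>
    ((isClosed_le (by fun_prop) (by fun_prop)).inter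
      (isClosed_le (by fun_prop) (by fun_prop)) :
        IsClosed (A ∩ {η | ‖b • η + τ‖ ≤ r'})).measurableSet
  have hshift : ∀ j : ℕ, volume (D ((b * j / a : ℝ) : UnitAddCircle)) = volume (D 0) := by
    intro j
    rw [← measure_preimage_add_right volume ((j / a : ℝ) : UnitAddCircle) (D 0)]
    congr 1
    ext η
    have e1 : a • ((j / a : ℝ) : UnitAddCircle) = 0 := by
      rw [← AddCircle.coe_nsmul, nsmul_eq_mul, mul_div_cancel₀ _ ha'.ne']
      exact AddCircle.coe_eq_zero_iff 1 |>.mpr ⟨j, by simp⟩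
    have e2 : b • ((j / a : ℝ) : UnitAddCircle) = ((b * j / a : ℝ) : UnitAddCircle) := by
      rw [← AddCircle.coe_nsmul, nsmul_eq_mul, mul_div_assoc]
    simp only [D, Set.mem_preimage, Set.mem_ofPred_eq, smul_add, e1, e2, add_zero]
  have hsum : (a : ENNReal) * volume (D 0) ≤ ENNReal.ofReal (2 * a * r' + 1) * volume A := by
    calc (a : ENNReal) * volume (D 0)
        = ∑ j ∈ Finset.range a, volume (D ((b * j / a : ℝ) : UnitAddCircle)) := by
          simp [hshift]
      _ = ∑ j ∈ Finset.range a, ∫⁻ η, (D ((b * j / a : ℝ) : UnitAddCircle)).indicator 1 η := by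
          simp [lintegral_indicator_one (hD _)]
      _ = ∫⁻ η, ∑ j ∈ Finset.range a, (D ((b * j / a : ℝ) : UnitAddCircle)).indicator 1 η :=
          (lintegral_finsetSum _ fun j _ => measurable_one.indicator (hD _)).symm
      _ ≤ ∫⁻ η, ENNReal.ofReal (2 * a * r' + 1) * A.indicator 1 η := by
          refine lintegral_mono fun η => ?_
          by_cases hη : η ∈ A
          · have := card_filter_norm_add_mul_div_le ha hab (b • η) hr'
            have hfil : ∑ j ∈ Finset.range a, (D ((b * j / a : ℝ) : UnitAddCircle)).indicator
                (1 : UnitAddCircle → ENNReal) η = (((Finset.range a).filter fun j : ℕ =>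
                ‖b • η + ((b * j / a : ℝ) : UnitAddCircle)‖ ≤ r').card : ENNReal) := by
              rw [Finset.card_filter, Nat.cast_sum]
              refine Finset.sum_congr rfl fun j _ => ?_
              have hη' : ‖a • η‖ ≤ r := hη
              by_cases h : ‖b • η + ((b * j / a : ℝ) : UnitAddCircle)‖ ≤ r' <;>
                simp [D, Set.indicator, hη', h]
            simp only [Set.indicator_of_mem hη, Pi.one_apply, mul_one]
            rw [hfil, ← ENNReal.ofReal_natCast]
            exact ENNReal.ofReal_le_ofReal this
          · have : ∀ τ, η ∉ D τ := fun τ h => hη h.1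
            simp [Set.indicator_of_notMem (this _), Set.indicator_of_notMem hη]
      _ = _ := by
          rw [lintegral_const_mul _ (measurable_one.indicator hA), lintegral_indicator_one hA]
  have hAvol : volume.real A ≤ 2 * r := by
    have h := volume_real_norm_torusForm_add_le (ι := Unit) (q := fun _ => a) (i := ())
      ha.ne' 0 r hr
    have h1 : volume.real A = volume.real {ξ : Unit → UnitAddCircle |
        ‖torusForm (fun _ => a) ξ + 0‖ ≤ r} := by
      have h2 := (measurePreserving_torusForm (ι := Unit) (q := fun _ => 1) (i := ())
        one_ne_zero).measureReal_preimage hA.nullMeasurableSet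
      rw [← h2]
      congr 1
      ext ξ
      simp [A, torusForm_apply]
    rw [h1, h]
    exact min_le_right _ _
  have hreal : a * volume.real (D 0) ≤ (2 * a * r' + 1) * volume.real A := by
    have := ENNReal.toReal_mono (by finiteness) hsum
    rwa [ENNReal.toReal_mul, ENNReal.toReal_mul, ENNReal.toReal_natCast,
      ENNReal.toReal_ofReal (by positivity)] at this
  have hD0 : {η : UnitAddCircle | ‖a • η‖ ≤ r ∧ ‖b • η‖ ≤ r'} = D 0 := by simp [D]
  rw [hD0]
  have : a * volume.real (D 0) ≤ (2 * a * r' + 1) * (2 * r) :=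
    hreal.trans (by gcongr)
  calc volume.real (D 0) = (a * volume.real (D 0)) / a := by field_simp
    _ ≤ (2 * a * r' + 1) * (2 * r) / a := by gcongr
    _ = _ := by field_simp

/-- If `a • η` and `b • η` are so close to `0` that `b r + a r' < 1`, with `a` and `b` coprime,
then `η` itself is close to `0`. -/
theorem norm_le_div_of_coprime {a b : ℕ} (ha : 0 < a) (hb : 0 < b) (hab : a.Coprime b)
    {r r' : ℝ} {η : UnitAddCircle} (h : ‖a • η‖ ≤ r) (hh : ‖b • η‖ ≤ r')
    (hlt : b * r + a * r' < 1) : ‖η‖ ≤ r / a ∧ ‖η‖ ≤ r' / b := by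
  obtain ⟨y, rfl⟩ := QuotientAddGroup.mk_surjective η
  have ha' : (0 : ℝ) < a := by exact_mod_cast ha
  have hb' : (0 : ℝ) < b := by exact_mod_cast hb
  change ‖a • ((y : ℝ) : UnitAddCircle)‖ ≤ r at h
  change ‖b • ((y : ℝ) : UnitAddCircle)‖ ≤ r' at hh
  change ‖((y : ℝ) : UnitAddCircle)‖ ≤ r / a ∧ ‖((y : ℝ) : UnitAddCircle)‖ ≤ r' / b
  rw [← AddCircle.coe_nsmul, nsmul_eq_mul, UnitAddCircle.norm_eq] at h hh
  set P := round (a * y)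
  set P' := round (b * y)
  have hzero : (a : ℤ) * P' - b * P = 0 := by
    rw [← Int.abs_lt_one_iff]
    have e : (a : ℝ) * P' - b * P = b * (a * y - P) - a * (b * y - P') := by ring
    have : |(a : ℝ) * P' - b * P| < 1 := by
      rw [e]
      calc _ ≤ |b * (a * y - P)| + |a * (b * y - P')| := abs_sub _ _
        _ = b * |a * y - P| + a * |b * y - P'| := by
            rw [abs_mul, abs_mul, abs_of_pos ha', abs_of_pos hb']
        _ ≤ b * r + a * r' := by gcongr
        _ < 1 := hlt
    exact_mod_cast this
  obtain ⟨s, hs⟩ : (a : ℤ) ∣ P :=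
    (Nat.isCoprime_iff_coprime.mpr hab).dvd_of_dvd_mul_left ⟨P', by linarith⟩
  have hs' : P' = b * s := by
    have : (a : ℤ) * P' = a * (b * s) := by rw [hs] at hzero; linarith
    exact mul_left_cancel₀ (by exact_mod_cast ha.ne') this
  have hy : ‖((y : ℝ) : UnitAddCircle)‖ ≤ |y - s| := by
    rw [UnitAddCircle.norm_eq]; exact round_le y s
  constructor
  · refine hy.trans ?_
    have e : (y - s) * a = a * y - P := by rw [hs]; push_cast; ring
    rw [le_div_iff₀ ha']
    calc |y - s| * a = |a * y - P| := by rw [← e, abs_mul, abs_of_pos ha']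
      _ ≤ r := h
  · refine hy.trans ?_
    have e : (y - s) * b = b * y - P' := by rw [hs']; push_cast; ring
    rw [le_div_iff₀ hb']
    calc |y - s| * b = |b * y - P'| := by rw [← e, abs_mul, abs_of_pos hb']
      _ ≤ r' := hh

/-- The points of the torus satisfying the inhomogeneous inequality `‖q · ξ + β‖ ≤ r / M`
which, for no common divisor `g > K` of `q`, are within `r / g` of an integer for the form
`M (q / g) · ξ`. -/
def rowSet {ι : Type*} [Fintype ι] (M K : ℕ) (q : ι → ℕ) (β : UnitAddCircle) (r : ℝ) :
    Set (ι → UnitAddCircle) :=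
  {ξ | ‖torusForm q ξ + β‖ ≤ r / M ∧
    ∀ g, K < g → (∀ j, g ∣ q j) → r / g < ‖M • torusForm (fun j => q j / g) ξ‖}

theorem volume_real_rowSet_inter_le_of_eq_mul {ι : Type*} [Fintype ι] {M K a b : ℕ} (hM : 0 < M)
    (ha : 0 < a) (hb : 0 < b) (hab : a.Coprime b) (hK : K < a ∨ K < b) {w : ι → ℕ} {i : ι}
    (hi : w i ≠ 0) {β : UnitAddCircle} (hβ : M • β = 0) {r r' : ℝ} (hr : 0 ≤ r) (hr' : 0 ≤ r') :
    volume.real (rowSet M K (fun j => a * w j) β r ∩ rowSet M K (fun j => b * w j) β r') ≤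
      8 * (r * r') := by
  have ha' : (0 : ℝ) < a := by exact_mod_cast ha
  have hb' : (0 : ℝ) < b := by exact_mod_cast hb
  have hM' : (0 : ℝ) < M := by exact_mod_cast hM
  have hform : ∀ ξ, torusForm (fun j => M * w j) ξ = M • torusForm w ξ := torusForm_smul M w
  have small : ∀ (c : ℕ) (s : ℝ) (ξ : ι → UnitAddCircle),
      ‖torusForm (fun j => c * w j) ξ + β‖ ≤ s / M →
      ‖c • torusForm (fun j => M * w j) ξ‖ ≤ s := by
    intro c s ξ h
    have e : c • torusForm (fun j => M * w j) ξ = M • (torusForm (fun j => c * w j) ξ + β) := by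
      rw [smul_add, hβ, add_zero, hform, torusForm_smul, smul_comm]
    rw [e]
    calc _ ≤ M * ‖torusForm (fun j => c * w j) ξ + β‖ := norm_nsmul_le
      _ ≤ M * (s / M) := by gcongr
      _ = s := by field_simp
  by_cases hlt : b * r + a * r' < 1
  · have hempty : rowSet M K (fun j => a * w j) β r ∩ rowSet M K (fun j => b * w j) β r' = ∅ := by
      rw [Set.eq_empty_iff_forall_notMem]
      rintro ξ ⟨h1, h2⟩
      obtain ⟨n1, n2⟩ := norm_le_div_of_coprime ha hb hab (small a r ξ h1.1) (small b r' ξ h2.1) hlt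
      rw [hform] at n1 n2
      rcases hK with hK | hK
      · have := h1.2 a hK fun j => dvd_mul_right _ _
        simp only [Nat.mul_div_cancel_left _ ha] at this
        exact absurd n1 (not_le.mpr this)
      · have := h2.2 b hK fun j => dvd_mul_right _ _
        simp only [Nat.mul_div_cancel_left _ hb] at this
        exact absurd n2 (not_le.mpr this)
    rw [hempty, measureReal_empty]
    positivity
  · push Not at hlt
    have hi' : (fun j => M * w j) i ≠ 0 := mul_ne_zero hM.ne' hi
    set D : Set UnitAddCircle := {η | ‖a • η‖ ≤ r ∧ ‖b • η‖ ≤ r'}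
    have hD : MeasurableSet D := ((isClosed_le (by fun_prop) (by fun_prop)).inter
      (isClosed_le (by fun_prop) (by fun_prop)) :
        IsClosed ({η : UnitAddCircle | ‖a • η‖ ≤ r} ∩ {η | ‖b • η‖ ≤ r'})).measurableSet
    have hDvol : volume.real D ≤ 8 * (r * r') := by
      by_cases hc : 1 ≤ 2 * (a * r')
      · have h1 : 1 / (a : ℝ) ≤ 2 * r' := by rw [div_le_iff₀ ha']; linarith
        calc volume.real D ≤ 2 * r * (2 * r' + 1 / a) := volume_real_nsmul_pair_le ha hab hr hr'
          _ ≤ 2 * r * (2 * r' + 2 * r') := by gcongr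
          _ = _ := by ring
      · have h1 : 1 / (b : ℝ) ≤ 2 * r := by rw [div_le_iff₀ hb']; linarith
        have hsymm : D = {η | ‖b • η‖ ≤ r' ∧ ‖a • η‖ ≤ r} := by ext; exact and_comm
        calc volume.real D ≤ 2 * r' * (2 * r + 1 / b) := by
              rw [hsymm]; exact volume_real_nsmul_pair_le hb hab.symm hr' hr
          _ ≤ 2 * r' * (2 * r + 2 * r) := by gcongr
          _ = _ := by ring
    refine le_trans ?_ hDvol
    rw [← (measurePreserving_torusForm (q := fun j => M * w j) (i := i)
      hi').measureReal_preimage hD.nullMeasurableSet]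
    exact measureReal_mono fun ξ h => ⟨small a r ξ h.1.1, small b r' ξ h.2.1⟩

theorem exists_mul_eq_or_volume_real_rowSet_inter_le {ι : Type*} [Fintype ι] {M K : ℕ}
    (hM : 0 < M) (i : ι) {q q' : ι → ℕ} (hq : ∀ j, 0 < q j) (hq' : ∀ j, 0 < q' j) :
    (∃ a ∈ Finset.Icc 1 K, ∃ b ∈ Finset.Icc 1 K, ∀ j, b * q j = a * q' j) ∨
      ∀ (β : UnitAddCircle) (r r' : ℝ), M • β = 0 → 0 ≤ r → 0 ≤ r' →
        volume.real (rowSet M K q β r ∩ rowSet M K q' β r') ≤ 8 * (r * r') := by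
  by_cases hpar : ∀ j, q i * q' j = q j * q' i
  · obtain ⟨g, a, b, hg, hab, ha, hb⟩ :
        ∃ g a b : ℕ, 0 < g ∧ a.Coprime b ∧ q i = a * g ∧ q' i = b * g :=
      ⟨Nat.gcd (q i) (q' i), _, _, Nat.gcd_pos_of_pos_left _ (hq i),
        Nat.coprime_div_gcd_div_gcd (Nat.gcd_pos_of_pos_left _ (hq i)),
        (Nat.div_mul_cancel (Nat.gcd_dvd_left _ _)).symm,
        (Nat.div_mul_cancel (Nat.gcd_dvd_right _ _)).symm⟩
    have ha0 : 0 < a := Nat.pos_of_mul_pos_right (ha ▸ hq i)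
    have hb0 : 0 < b := Nat.pos_of_mul_pos_right (hb ▸ hq' i)
    have hrel : ∀ j, b * q j = a * q' j := by
      intro j
      have := hpar j
      rw [ha, hb] at this
      refine Nat.eq_of_mul_eq_mul_right hg ?_
      linarith
    by_cases hK : K < a ∨ K < b
    · right
      intro β r r' hβ hr hr'
      have hdvd : ∀ j, a ∣ q j := fun j => hab.dvd_of_dvd_mul_left ⟨q' j, hrel j⟩
      choose w hw using hdvd
      have hqw : q = fun j => a * w j := funext hw
      have hqw' : q' = fun j => b * w j := by
        funext j
        refine Nat.eq_of_mul_eq_mul_left ha0 ?_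
        rw [← hrel j, hw j]; ring
      have hwi : w i ≠ 0 := fun h => (hq i).ne' (by rw [hw i, h, mul_zero])
      rw [hqw, hqw']
      exact volume_real_rowSet_inter_le_of_eq_mul hM ha0 hb0 hab hK hwi hβ hr hr'
    · push Not at hK
      exact Or.inl ⟨a, Finset.mem_Icc.mpr ⟨ha0, hK.1⟩, b, Finset.mem_Icc.mpr ⟨hb0, hK.2⟩, hrel⟩
  · right
    push Not at hpar
    obtain ⟨j, hj⟩ := hpar
    intro β r r' _ hr hr'
    have h1M : (1 : ℝ) ≤ M := by exact_mod_cast hM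
    calc volume.real (rowSet M K q β r ∩ rowSet M K q' β r')
        ≤ volume.real ({ξ : ι → UnitAddCircle | ‖torusForm q ξ + β‖ ≤ r / M} ∩
            {ξ | ‖torusForm q' ξ + β‖ ≤ r' / M}) :=
          measureReal_mono fun ξ h => ⟨h.1.1, h.2.1⟩
      _ ≤ 4 * (r / M * (r' / M)) :=
          volume_real_norm_torusForm_pair_le hj β β (by positivity) (by positivity)
      _ ≤ 4 * (r * r') := by
          gcongr <;> exact div_le_self ‹_› h1M
      _ ≤ 8 * (r * r') := by nlinarith [mul_nonneg hr hr']

theorem measurableSet_rowSet {ι : Type*} [Fintype ι] (M K : ℕ) (q : ι → ℕ) (β : UnitAddCircle)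
    (r : ℝ) : MeasurableSet (rowSet M K q β r) := by
  have : rowSet M K q β r = {ξ | ‖torusForm q ξ + β‖ ≤ r / M} ∩
      ⋂ g : ℕ, ⋂ (_ : K < g), ⋂ (_ : ∀ j, g ∣ q j),
        {ξ | r / g < ‖M • torusForm (fun j => q j / g) ξ‖} := by
    ext ξ
    simp [rowSet]
  rw [this]
  refine (isClosed_norm_torusForm_add_le q β _).measurableSet.inter (MeasurableSet.iInter fun g =>
    MeasurableSet.iInter fun _ => MeasurableSet.iInter fun _ => IsOpen.measurableSet ?_)
  exact isOpen_lt continuous_const ((continuous_torusForm _).const_smul M).norm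

theorem le_volume_real_rowSet {ι : Type*} [Fintype ι] {M K : ℕ} (hM : 0 < M) {q : ι → ℕ} {i : ι}
    (hi : 0 < q i) (hgood : ∑ g ∈ (q i).divisors with K < g, (1 / g : ℝ) ≤ 1 / (2 * M))
    (β : UnitAddCircle) {r : ℝ} (hr : 0 ≤ r) (hr' : r ≤ 1 / 2) :
    r / M ≤ volume.real (rowSet M K q β r) := by
  classical
  have hM' : (1 : ℝ) ≤ M := by exact_mod_cast hM
  set A : Set (ι → UnitAddCircle) := {ξ | ‖torusForm q ξ + β‖ ≤ r / M}
  set B : ℕ → Set (ι → UnitAddCircle) := fun g =>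
    {ξ | ‖torusForm (fun j => M * (q j / g)) ξ + 0‖ ≤ r / g}
  set F : Finset ℕ := (q i).divisors.filter fun g => K < g ∧ ∀ j, g ∣ q j
  have hsub : A \ ⋃ g ∈ F, B g ⊆ rowSet M K q β r := by
    rintro ξ ⟨hA, hB⟩
    refine ⟨hA, fun g hg hdvd => ?_⟩
    by_contra! h
    refine hB (Set.mem_biUnion (x := g) ?_ ?_)
    · exact Finset.mem_filter.mpr ⟨Nat.mem_divisors.mpr ⟨hdvd i, hi.ne'⟩, hg, hdvd⟩
    · change ‖torusForm (fun j => M * (q j / g)) ξ + 0‖ ≤ r / g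
      rwa [torusForm_smul, add_zero]
  have hAvol : volume.real A = 2 * (r / M) := by
    rw [volume_real_norm_torusForm_add_le hi.ne' _ _ (by positivity), min_eq_right]
    have : r / M ≤ r := div_le_self hr hM'
    linarith
  have hBvol : ∀ g ∈ F, volume.real (B g) ≤ 2 * r * (1 / g) := by
    intro g hg
    obtain ⟨hg1, hg2, hg3⟩ := Finset.mem_filter.mp hg
    have hqg : M * (q i / g) ≠ 0 :=
      mul_ne_zero hM.ne' (Nat.div_pos (Nat.le_of_dvd hi (hg3 i)) (by omega)).ne'
    rw [volume_real_norm_torusForm_add_le (q := fun j => M * (q j / g)) hqg _ _ (by positivity)]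
    exact (min_le_right _ _).trans_eq (by ring)
  have hUvol : volume.real (⋃ g ∈ F, B g) ≤ r / M := by
    calc volume.real (⋃ g ∈ F, B g) ≤ ∑ g ∈ F, volume.real (B g) :=
          measureReal_biUnion_finset_le F B
      _ ≤ ∑ g ∈ F, 2 * r * (1 / g) := Finset.sum_le_sum hBvol
      _ ≤ ∑ g ∈ (q i).divisors with K < g, 2 * r * (1 / g : ℝ) := by
          refine Finset.sum_le_sum_of_subset_of_nonneg ?_ fun _ _ _ => by positivity
          exact Finset.monotone_filter_right _ fun g _ h => h.1
      _ ≤ 2 * r * (1 / (2 * M)) := by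
          rw [← Finset.mul_sum]
          gcongr
      _ = r / M := by field_simp
  calc r / M = 2 * (r / M) - r / M := by ring
    _ ≤ volume.real A - volume.real (⋃ g ∈ F, B g) := by linarith
    _ ≤ volume.real (A \ ⋃ g ∈ F, B g) := le_measureReal_sdiff (measure_ne_top _ _)
    _ ≤ _ := measureReal_mono hsub

/-- The systems of `κ` linear forms on the torus all of whose rows lie in `rowSet`. -/
def matSet {κ ι : Type*} [Fintype ι] (M K : ℕ) (β : κ → UnitAddCircle) (q : ι → ℕ) (r : ℝ) :
    Set (κ → ι → UnitAddCircle) :=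
  Set.univ.pi fun i => rowSet M K q (β i) r

theorem measurableSet_matSet {κ ι : Type*} [Fintype κ] [Fintype ι] (M K : ℕ)
    (β : κ → UnitAddCircle) (q : ι → ℕ) (r : ℝ) : MeasurableSet (matSet M K β q r) :=
  MeasurableSet.univ_pi fun _ => measurableSet_rowSet _ _ _ _ _

theorem volume_real_univ_pi {κ X : Type*} [Fintype κ] [MeasureSpace X]
    [SigmaFinite (volume : Measure X)] (s : κ → Set X) :
    volume.real (Set.univ.pi s) = ∏ i, volume.real (s i) := by
  simp only [measureReal_def, volume_pi, Measure.pi_pi, ENNReal.toReal_prod]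

theorem le_volume_real_matSet {κ ι : Type*} [Fintype κ] [Fintype ι] {M K : ℕ} (hM : 0 < M)
    {q : ι → ℕ} {i : ι} (hi : 0 < q i)
    (hgood : ∑ g ∈ (q i).divisors with K < g, (1 / g : ℝ) ≤ 1 / (2 * M))
    (β : κ → UnitAddCircle) {r : ℝ} (hr : 0 ≤ r) (hr' : r ≤ 1 / 2) :
    (r / M) ^ Fintype.card κ ≤ volume.real (matSet M K β q r) := by
  rw [matSet, volume_real_univ_pi, ← Finset.card_univ, ← Finset.prod_const]
  exact Finset.prod_le_prod (fun _ _ => by positivity)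
    fun k _ => le_volume_real_rowSet hM hi hgood (β k) hr hr'

theorem volume_real_matSet_inter_le {κ ι : Type*} [Fintype κ] [Fintype ι] {M K : ℕ} (hM : 0 < M)
    {i : ι} {q q' : ι → ℕ} (hq : ∀ j, 0 < q j) (hq' : ∀ j, 0 < q' j)
    (hgood : ∑ g ∈ (q i).divisors with K < g, (1 / g : ℝ) ≤ 1 / (2 * M))
    (hgood' : ∑ g ∈ (q' i).divisors with K < g, (1 / g : ℝ) ≤ 1 / (2 * M))
    {β : κ → UnitAddCircle} (hβ : ∀ k, M • β k = 0) {r r' : ℝ} (hr : 0 ≤ r) (hr1 : r ≤ 1 / 2)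
    (hr' : 0 ≤ r') (hrone : r' ≤ 1 / 2) :
    (∃ a ∈ Finset.Icc 1 K, ∃ b ∈ Finset.Icc 1 K, ∀ j, b * q j = a * q' j) ∨
      volume.real (matSet M K β q r ∩ matSet M K β q' r') ≤
        (8 * M ^ 2 : ℝ) ^ Fintype.card κ *
          (volume.real (matSet M K β q r) * volume.real (matSet M K β q' r')) := by
  refine (exists_mul_eq_or_volume_real_rowSet_inter_le (K := K) hM i hq hq').imp id fun h => ?_
  have hM' : (0 : ℝ) < M := by exact_mod_cast hM
  calc volume.real (matSet M K β q r ∩ matSet M K β q' r')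
      = ∏ k, volume.real (rowSet M K q (β k) r ∩ rowSet M K q' (β k) r') := by
        rw [matSet, matSet, ← Set.pi_inter_distrib, volume_real_univ_pi]
    _ ≤ ∏ _k : κ, 8 * (r * r') :=
        Finset.prod_le_prod (fun _ _ => measureReal_nonneg) fun k _ => h _ _ _ (hβ k) hr hr'
    _ = (8 * M ^ 2 : ℝ) ^ Fintype.card κ *
          ((r / M) ^ Fintype.card κ * (r' / M) ^ Fintype.card κ) := by
        rw [Finset.prod_const, Finset.card_univ, ← mul_pow, ← mul_pow]
        congr 1
        field_simp
    _ ≤ _ := by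
        gcongr
        · exact le_volume_real_matSet hM (hq i) hgood β hr hr1
        · exact le_volume_real_matSet hM (hq' i) hgood' β hr' hrone

/-- A second moment bound: events which are quasi-independent up to a bounded number of exceptions
for each of them have a union of measure bounded below. -/
theorem one_le_mul_measureReal_biUnion {Ω α : Type*} [MeasurableSpace Ω] {μ : Measure Ω}
    [IsProbabilityMeasure μ] {I : Finset α} {A : α → Set Ω} (hA : ∀ x, MeasurableSet (A x))
    {C L : ℝ} (rel : α → α → Prop) [DecidableRel rel]
    (hind : ∀ x ∈ I, ∀ y ∈ I, rel x y ∨ μ.real (A x ∩ A y) ≤ C * (μ.real (A x) * μ.real (A y)))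
    (hrel : ∀ x ∈ I, ((I.filter (rel x)).card : ℝ) ≤ L) (hC : 0 ≤ C)
    (hpos : 0 < ∑ x ∈ I, μ.real (A x)) (hL : L ≤ ∑ x ∈ I, μ.real (A x)) :
    1 ≤ (C + 1) * μ.real (⋃ x ∈ I, A x) := by
  set S := ∑ x ∈ I, μ.real (A x) with hS
  set U := ⋃ x ∈ I, A x with hU
  have hUm : MeasurableSet U := Finset.measurableSet_biUnion I fun x _ => hA x
  let N : Ω → ℝ := fun ω => ∑ x ∈ I, (A x).indicator 1 ω
  have hint : ∀ s : Set Ω, MeasurableSet s → Integrable (s.indicator (1 : Ω → ℝ)) μ :=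
    fun s hs => (integrable_const (1 : ℝ)).indicator hs
  have hN : ∫ ω, N ω ∂μ = S := by
    rw [integral_finsetSum _ fun x _ => hint _ (hA x)]
    exact Finset.sum_congr rfl fun x _ => integral_indicator_one (hA x)
  have hNsq : ∀ ω, N ω ^ 2 = ∑ x ∈ I, ∑ y ∈ I, (A x ∩ A y).indicator 1 ω := by
    intro ω
    rw [sq, Finset.sum_mul_sum]
    refine Finset.sum_congr rfl fun x _ => Finset.sum_congr rfl fun y _ => ?_
    rw [Set.inter_indicator_one, Pi.mul_apply]
  have hN2 : ∫ ω, N ω ^ 2 ∂μ = ∑ x ∈ I, ∑ y ∈ I, μ.real (A x ∩ A y) := by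
    simp_rw [hNsq]
    rw [integral_finsetSum _ fun x _ =>
      integrable_finsetSum _ fun y _ => hint _ ((hA x).inter (hA y))]
    refine Finset.sum_congr rfl fun x _ => ?_
    rw [integral_finsetSum _ fun y _ => hint _ ((hA x).inter (hA y))]
    exact Finset.sum_congr rfl fun y _ => integral_indicator_one ((hA x).inter (hA y))
  have hrow : ∀ x ∈ I, ∑ y ∈ I, μ.real (A x ∩ A y) ≤ C * (μ.real (A x) * S) + L * μ.real (A x) := by
    intro x hx
    calc ∑ y ∈ I, μ.real (A x ∩ A y)
        ≤ ∑ y ∈ I, (C * (μ.real (A x) * μ.real (A y)) + if rel x y then μ.real (A x) else 0) := by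
          refine Finset.sum_le_sum fun y hy => ?_
          rcases hind x hx y hy with h | h
          · rw [if_pos h]
            have : μ.real (A x ∩ A y) ≤ μ.real (A x) := measureReal_mono Set.inter_subset_left
            have : 0 ≤ C * (μ.real (A x) * μ.real (A y)) := by positivity
            linarith
          · refine h.trans (le_add_of_nonneg_right ?_)
            split_ifs <;> positivity
      _ = C * (μ.real (A x) * S) + (I.filter (rel x)).card * μ.real (A x) := by
          rw [Finset.sum_add_distrib, ← Finset.mul_sum, ← Finset.mul_sum, ← Finset.sum_filter,
            Finset.sum_const, nsmul_eq_mul]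
      _ ≤ _ := by
          gcongr
          exact hrel x hx
  have hN2le : ∫ ω, N ω ^ 2 ∂μ ≤ (C + 1) * S ^ 2 := by
    rw [hN2]
    calc _ ≤ ∑ x ∈ I, (C * (μ.real (A x) * S) + L * μ.real (A x)) := Finset.sum_le_sum hrow
      _ = C * S ^ 2 + L * S := by
          rw [Finset.sum_add_distrib, ← Finset.mul_sum, ← Finset.mul_sum, ← Finset.sum_mul, ← hS]
          ring
      _ ≤ C * S ^ 2 + S * S := by gcongr
      _ = _ := by ring
  set t := (C + 1) * S
  have hpt : ∀ ω, 2 * t * N ω ≤ t ^ 2 * U.indicator 1 ω + N ω ^ 2 := by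
    intro ω
    by_cases hω : ω ∈ U
    · rw [Set.indicator_of_mem hω, Pi.one_apply]
      nlinarith [sq_nonneg (t - N ω)]
    · have : N ω = 0 := Finset.sum_eq_zero fun x hx =>
        Set.indicator_of_notMem (fun h => hω (Set.mem_biUnion hx h)) _
      simp [this, Set.indicator_of_notMem hω]
  have hNint : Integrable N μ := integrable_finsetSum _ fun x _ => hint _ (hA x)
  have hN2int : Integrable (fun ω => N ω ^ 2) μ := by
    simp_rw [hNsq]
    exact integrable_finsetSum _ fun x _ =>
      integrable_finsetSum _ fun y _ => hint _ ((hA x).inter (hA y))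
  have hI := integral_mono (hNint.const_mul (2 * t)) (((hint U hUm).const_mul (t ^ 2)).add hN2int)
    hpt
  simp only [Pi.add_apply] at hI
  rw [integral_const_mul, hN, integral_add ((hint U hUm).const_mul _) hN2int, integral_const_mul,
    integral_indicator_one hUm] at hI
  have hfin : (C + 1) * S ^ 2 * 1 ≤ (C + 1) * S ^ 2 * ((C + 1) * μ.real U) := by
    have e1 : 2 * t * S = 2 * ((C + 1) * S ^ 2) := by simp only [t]; ring
    have e2 : t ^ 2 * μ.real U = (C + 1) * S ^ 2 * ((C + 1) * μ.real U) := by simp only [t]; ring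
    rw [e1, e2] at hI
    linarith
  exact le_of_mul_le_mul_left hfin (by positivity)

/-- The integers of the dyadic block `[2 ^ k, 2 ^ (k + 1))` congruent to `w` modulo `M` whose large
divisors have a small sum of reciprocals. -/
noncomputable def goodBlock (M K w k : ℕ) : Finset ℕ :=
  {h ∈ Finset.Ico (2 ^ k) (2 ^ (k + 1)) | h ≡ w [MOD M] ∧
    ∑ g ∈ h.divisors with K < g, (1 / g : ℝ) ≤ 1 / (2 * M)}

theorem le_card_filter_modEq {M : ℕ} (hM : 0 < M) (w k : ℕ) (hk : 2 * M ≤ 2 ^ k) :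
    (2 ^ k : ℝ) / (2 * M) ≤
      ((Finset.Ico (2 ^ k) (2 ^ (k + 1))).filter (fun h => h ≡ w [MOD M])).card := by
  have h1 := Nat.Ico_filter_modEq_card (2 ^ k) (2 ^ (k + 1)) hM w
  have h2 : ((2 ^ k : ℚ) / M - 1) ≤
      (((Finset.Ico (2 ^ k) (2 ^ (k + 1))).filter (fun h => h ≡ w [MOD M])).card : ℤ) := by
    rw [h1]
    push_cast
    refine le_max_of_le_left ?_
    have h3 := Int.le_ceil (((2 ^ (k + 1) : ℚ) - w) / M)
    have h4 := Int.ceil_lt_add_one (((2 ^ k : ℚ) - w) / M)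
    have h5 : ((2 ^ (k + 1) : ℚ) - w) / M - ((2 ^ k : ℚ) - w) / M = 2 ^ k / M := by ring
    linarith
  have h3 : ((2 ^ k : ℝ) / M - 1) ≤
      ((Finset.Ico (2 ^ k) (2 ^ (k + 1))).filter (fun h => h ≡ w [MOD M])).card := by
    have := (Rat.cast_le (K := ℝ)).2 h2
    push_cast at this
    exact this
  have hM' : (0 : ℝ) < M := by exact_mod_cast hM
  have h4 : (1 : ℝ) ≤ 2 ^ k / (2 * M) := by
    rw [le_div_iff₀ (by positivity), one_mul]
    exact_mod_cast hk
  have h5 : (2 ^ k : ℝ) / M = 2 ^ k / (2 * M) + 2 ^ k / (2 * M) := by field_simp; norm_num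
  linarith

theorem sum_sum_divisors_inv_le {K : ℕ} (hK : 0 < K) (X : ℕ) :
    ∑ h ∈ Finset.Ioc 0 X, ∑ g ∈ h.divisors with K < g, (1 / g : ℝ) ≤ X / K := by
  have hK' : (0 : ℝ) < K := by exact_mod_cast hK
  rcases le_total X K with hX | hX
  · refine (Finset.sum_nonpos fun h hh => ?_).trans (by positivity)
    rw [Finset.filter_false_of_mem, Finset.sum_empty]
    intro g hg
    have := Nat.divisor_le hg
    have := (Finset.mem_Ioc.1 hh).2
    omega
  calc ∑ h ∈ Finset.Ioc 0 X, ∑ g ∈ h.divisors with K < g, (1 / g : ℝ)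
      = ∑ g ∈ Finset.Ioc K X, ∑ h ∈ Finset.Ioc 0 X with g ∣ h, (1 / g : ℝ) := by
        refine Finset.sum_comm' fun h g => ?_
        simp only [Finset.mem_Ioc, Finset.mem_filter, Nat.mem_divisors]
        constructor
        · rintro ⟨⟨h0, hX⟩, ⟨hd, -⟩, hg⟩
          exact ⟨⟨⟨h0, hX⟩, hd⟩, hg, (Nat.le_of_dvd h0 hd).trans hX⟩
        · rintro ⟨⟨⟨h0, hX⟩, hd⟩, hg, -⟩
          exact ⟨⟨h0, hX⟩, ⟨hd, h0.ne'⟩, hg⟩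
    _ ≤ ∑ g ∈ Finset.Ioc K X, X * ((g : ℝ) ^ 2)⁻¹ := by
        refine Finset.sum_le_sum fun g _ => ?_
        rw [Finset.sum_const, Nat.Ioc_filter_dvd_card_eq_div, nsmul_eq_mul]
        calc ((X / g : ℕ) : ℝ) * (1 / g) ≤ X / g * (1 / g) := by
              gcongr
              exact Nat.cast_div_le
          _ = _ := by field_simp
    _ ≤ X * ((K : ℝ)⁻¹ - (X : ℝ)⁻¹) := by
        rw [← Finset.mul_sum]
        gcongr
        exact sum_Ioc_inv_sq_le_sub hK.ne' hX
    _ ≤ X / K := by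
        rw [div_eq_mul_inv]
        gcongr
        exact sub_le_self _ (by positivity)

theorem le_card_goodBlock {M K : ℕ} (hM : 0 < M) (hK : K = 16 * M ^ 2) (w k : ℕ)
    (hk : 2 * M ≤ 2 ^ k) : (2 ^ k : ℝ) / (4 * M) ≤ (goodBlock M K w k).card := by
  have hM' : (0 : ℝ) < M := by exact_mod_cast hM
  have hK0 : 0 < K := by rw [hK]; positivity
  set f : ℕ → ℝ := fun h => ∑ g ∈ h.divisors with K < g, (1 / g : ℝ)
  set I := (Finset.Ico (2 ^ k) (2 ^ (k + 1))).filter (fun h => h ≡ w [MOD M])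
  have hsub : I ⊆ Finset.Ioc 0 (2 ^ (k + 1)) := by
    intro h hh
    have := Finset.mem_Ico.1 (Finset.mem_filter.1 hh).1
    have : 0 < 2 ^ k := by positivity
    rw [Finset.mem_Ioc]
    omega
  have hbad : ((I.filter fun h => ¬ f h ≤ 1 / (2 * M)).card : ℝ) * (1 / (2 * M)) ≤
      2 ^ (k + 1) / K := by
    calc ((I.filter fun h => ¬ f h ≤ 1 / (2 * M)).card : ℝ) * (1 / (2 * M))
        ≤ ∑ h ∈ I with ¬ f h ≤ 1 / (2 * M), f h := by
          rw [← nsmul_eq_mul]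
          exact Finset.card_nsmul_le_sum _ _ _ fun h hh =>
            (not_le.1 (Finset.mem_filter.1 hh).2).le
      _ ≤ ∑ h ∈ Finset.Ioc 0 (2 ^ (k + 1)), f h :=
          Finset.sum_le_sum_of_subset_of_nonneg ((Finset.filter_subset _ _).trans hsub)
            fun h _ _ => Finset.sum_nonneg fun _ _ => by positivity
      _ ≤ _ := by
          have := sum_sum_divisors_inv_le hK0 (2 ^ (k + 1))
          push_cast at this
          exact this
  have hgood : goodBlock M K w k = I.filter fun h => f h ≤ 1 / (2 * M) := by
    rw [Finset.filter_filter]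
    rfl
  have hcard := Finset.card_filter_add_card_filter_not (s := I) (fun h => f h ≤ 1 / (2 * M))
  rw [← hgood] at hcard
  have hcard' : ((goodBlock M K w k).card : ℝ) +
      (I.filter fun h => ¬ f h ≤ 1 / (2 * M)).card = I.card := by exact_mod_cast hcard
  have hI : (2 ^ k : ℝ) / (2 * M) ≤ I.card := le_card_filter_modEq hM w k hk
  have e : (2 ^ (k + 1) : ℝ) / K = 2 ^ k / (4 * M) * (1 / (2 * M)) := by
    rw [hK]
    push_cast
    field_simp
    ring
  rw [e] at hbad
  have := le_of_mul_le_mul_right hbad (by positivity)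
  have h5 : (2 ^ k : ℝ) / (2 * M) = 2 ^ k / (4 * M) + 2 ^ k / (4 * M) := by field_simp; norm_num
  linarith

/-- The integer vectors all of whose coordinates lie in a `goodBlock`. -/
noncomputable def vecBlock {ι : Type*} [Fintype ι] [DecidableEq ι] (M K : ℕ) (w : ι → ℕ) (k : ℕ) :
    Finset (ι → ℕ) :=
  Fintype.piFinset fun j => goodBlock M K (w j) k

section vecBlock

variable {ι : Type*} [Fintype ι] [DecidableEq ι] {M K k : ℕ} {w q : ι → ℕ}

theorem le_of_mem_vecBlock (hq : q ∈ vecBlock M K w k) (j : ι) : 2 ^ k ≤ q j :=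
  (Finset.mem_Ico.1 (Finset.mem_filter.1 (Fintype.mem_piFinset.1 hq j)).1).1

theorem lt_of_mem_vecBlock (hq : q ∈ vecBlock M K w k) (j : ι) : q j < 2 ^ (k + 1) :=
  (Finset.mem_Ico.1 (Finset.mem_filter.1 (Fintype.mem_piFinset.1 hq j)).1).2

theorem modEq_of_mem_vecBlock (hq : q ∈ vecBlock M K w k) (j : ι) : q j ≡ w j [MOD M] :=
  (Finset.mem_filter.1 (Fintype.mem_piFinset.1 hq j)).2.1

theorem sum_divisors_le_of_mem_vecBlock (hq : q ∈ vecBlock M K w k) (j : ι) :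
    ∑ g ∈ (q j).divisors with K < g, (1 / g : ℝ) ≤ 1 / (2 * M) :=
  (Finset.mem_filter.1 (Fintype.mem_piFinset.1 hq j)).2.2

theorem pos_of_mem_vecBlock (hq : q ∈ vecBlock M K w k) (j : ι) : 0 < q j :=
  (by positivity : 0 < 2 ^ k).trans_le (le_of_mem_vecBlock hq j)

theorem log_of_mem_vecBlock (hq : q ∈ vecBlock M K w k) (j : ι) : Nat.log 2 (q j) = k :=
  (Nat.log_eq_iff (Or.inr ⟨by norm_num, (pos_of_mem_vecBlock hq j).ne'⟩)).2
    ⟨le_of_mem_vecBlock hq j, lt_of_mem_vecBlock hq j⟩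

theorem le_card_vecBlock (hM : 0 < M) (hK : K = 16 * M ^ 2) (w : ι → ℕ) (hk : 2 * M ≤ 2 ^ k) :
    ((2 ^ k : ℝ) / (4 * M)) ^ Fintype.card ι ≤ (vecBlock M K w k).card := by
  rw [vecBlock, Fintype.card_piFinset, ← Finset.card_univ, ← Finset.prod_const]
  push_cast
  exact Finset.prod_le_prod (fun _ _ => by positivity) fun j _ => le_card_goodBlock hM hK _ _ hk

end vecBlock

theorem card_filter_commensurable_le {ι : Type*} [Fintype ι] [DecidableEq ι] (K : ℕ)
    (I : Finset (ι → ℕ)) (x : ι → ℕ) (P : (ι → ℕ) → Prop) [DecidablePred P]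
    (hP : ∀ y, P y → ∃ a ∈ Finset.Icc 1 K, ∃ b ∈ Finset.Icc 1 K, ∀ j, b * x j = a * y j) :
    (I.filter P).card ≤ K ^ 2 := by
  refine (Finset.card_le_card (t := (Finset.Icc 1 K ×ˢ Finset.Icc 1 K).image
    fun ab j => ab.2 * x j / ab.1) fun y hy => ?_).trans (Finset.card_image_le.trans ?_)
  · obtain ⟨a, ha, b, hb, h⟩ := hP y (Finset.mem_filter.1 hy).2
    refine Finset.mem_image.2 ⟨(a, b), Finset.mem_product.2 ⟨ha, hb⟩, funext fun j => ?_⟩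
    simp only [h j]
    exact Nat.mul_div_cancel_left _ (Finset.mem_Icc.1 ha).1
  · rw [Finset.card_product, Nat.card_Icc, sq, Nat.add_sub_cancel]

section LimsupTorus

variable {κ ι : Type*} [Fintype κ] [Fintype ι] [DecidableEq ι] [Nonempty ι]
  {M K : ℕ} {β : κ → UnitAddCircle} {ρ : ℕ → ℝ}

theorem le_sum_volume_real_matSet (hM : 0 < M) (hK : K = 16 * M ^ 2) (w : ι → ℕ)
    (hρ : ∀ k, 0 ≤ ρ k) (hρ' : ∀ k, ρ k ≤ 1 / 2) (k₁ X : ℕ) (hk₁ : 2 * M ≤ 2 ^ k₁) :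
    (1 / (4 * M) : ℝ) ^ Fintype.card ι * (1 / M : ℝ) ^ Fintype.card κ *
        ∑ k ∈ Finset.Ico k₁ X, ((2 : ℝ) ^ k) ^ Fintype.card ι * ρ k ^ Fintype.card κ ≤
      ∑ k ∈ Finset.Ico k₁ X, ∑ q ∈ vecBlock M K w k, volume.real (matSet M K β q (ρ k)) := by
  obtain ⟨j⟩ := ‹Nonempty ι›
  rw [Finset.mul_sum]
  refine Finset.sum_le_sum fun k hk => ?_
  have hk' : 2 * M ≤ 2 ^ k :=
    hk₁.trans (Nat.pow_le_pow_right (by norm_num) (Finset.mem_Ico.1 hk).1)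
  calc _ = ((2 ^ k : ℝ) / (4 * M)) ^ Fintype.card ι * (ρ k / M) ^ Fintype.card κ := by
        simp only [div_pow, one_pow]
        ring
    _ ≤ (vecBlock M K w k).card * (ρ k / M) ^ Fintype.card κ := by
        have := hρ k
        gcongr
        exact le_card_vecBlock hM hK w hk'
    _ ≤ _ := by
        rw [← nsmul_eq_mul]
        exact Finset.card_nsmul_le_sum _ _ _ fun q hq =>
          le_volume_real_matSet hM (pos_of_mem_vecBlock hq j)
            (sum_divisors_le_of_mem_vecBlock hq j) β (hρ k) (hρ' k)

theorem one_le_mul_volume_real_iUnion_matSet (hM : 0 < M) (hK : K = 16 * M ^ 2)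
    (hβ : ∀ i, M • β i = 0) (w : ι → ℕ) (hρ : ∀ k, 0 ≤ ρ k) (hρ' : ∀ k, ρ k ≤ 1 / 2)
    (hdiv : ¬ Summable fun k => ((2 : ℝ) ^ k) ^ Fintype.card ι * ρ k ^ Fintype.card κ) (k₀ : ℕ) :
    1 ≤ ((8 * M ^ 2 : ℝ) ^ Fintype.card κ + 1) *
      volume.real (⋃ k ≥ k₀, ⋃ q ∈ vecBlock M K w k, matSet M K β q (ρ k)) := by
  classical
  have hM' : (0 : ℝ) < M := by exact_mod_cast hM
  have hK0 : 0 < K := by rw [hK]; positivity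
  obtain ⟨j⟩ := ‹Nonempty ι›
  set a : ℕ → ℝ := fun k => ((2 : ℝ) ^ k) ^ Fintype.card ι * ρ k ^ Fintype.card κ
  set c : ℝ := (1 / (4 * M) : ℝ) ^ Fintype.card ι * (1 / M : ℝ) ^ Fintype.card κ
  have hc : 0 < c := by positivity
  set k₁ := k₀ + 2 * M
  have hk₁ : 2 * M ≤ 2 ^ k₁ :=
    (Nat.le_add_left _ _).trans (Nat.lt_two_pow_self (n := k₁)).le
  have hlim := (not_summable_iff_tendsto_nat_atTop_of_nonneg
    (fun k => by have := hρ k; positivity)).1 hdiv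
  obtain ⟨X, hX₁, hX⟩ := ((Filter.eventually_ge_atTop k₁).and
    (hlim.eventually_ge_atTop (∑ k ∈ Finset.range k₁, a k + (K : ℝ) ^ 2 / c))).exists
  set I := (Finset.Ico k₁ X).biUnion (vecBlock M K w)
  let A : (ι → ℕ) → Set (κ → ι → UnitAddCircle) := fun q => matSet M K β q (ρ (Nat.log 2 (q j)))
  have hA : ∀ k, ∀ q ∈ vecBlock M K w k, A q = matSet M K β q (ρ k) := fun k q hq => by
    simp only [A, log_of_mem_vecBlock hq j]
  have hsum : (K : ℝ) ^ 2 ≤ ∑ q ∈ I, volume.real (A q) := by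
    rw [Finset.sum_biUnion]
    · calc (K : ℝ) ^ 2 = c * (K ^ 2 / c) := by field_simp
        _ ≤ c * ∑ k ∈ Finset.Ico k₁ X, a k := by
            rw [Finset.sum_Ico_eq_sub _ hX₁]
            gcongr
            linarith
        _ ≤ _ := le_sum_volume_real_matSet (β := β) hM hK w hρ hρ' k₁ X hk₁
        _ = _ := Finset.sum_congr rfl fun k _ => Finset.sum_congr rfl fun q hq => by rw [hA k q hq]
    · intro k _ k' _ hkk'
      refine Finset.disjoint_left.2 fun q hq hq' => hkk' ?_
      rw [← log_of_mem_vecBlock hq j, log_of_mem_vecBlock hq' j]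
  have hKsq : (0 : ℝ) < (K : ℝ) ^ 2 := by positivity
  obtain ⟨rel, hrel⟩ : ∃ rel : (ι → ℕ) → (ι → ℕ) → Prop, ∀ x y, rel x y ↔
      ∃ a ∈ Finset.Icc 1 K, ∃ b ∈ Finset.Icc 1 K, ∀ j, b * x j = a * y j :=
    ⟨_, fun _ _ => Iff.rfl⟩
  have key := one_le_mul_measureReal_biUnion (μ := volume) (I := I) (A := A)
    (fun q => measurableSet_matSet M K β q _) (C := (8 * M ^ 2 : ℝ) ^ Fintype.card κ)
    (L := (K : ℝ) ^ 2)
    rel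
    (fun x hx y hy => by
      obtain ⟨k, -, hk⟩ := Finset.mem_biUnion.1 hx
      obtain ⟨k', -, hk'⟩ := Finset.mem_biUnion.1 hy
      rw [hrel]
      exact volume_real_matSet_inter_le hM (pos_of_mem_vecBlock hk) (pos_of_mem_vecBlock hk')
        (sum_divisors_le_of_mem_vecBlock hk j) (sum_divisors_le_of_mem_vecBlock hk' j) hβ
        (hρ _) (hρ' _) (hρ _) (hρ' _))
    (fun x _ => by exact_mod_cast card_filter_commensurable_le K I x _ fun y => (hrel x y).1)
    (by positivity) (hKsq.trans_le hsum) hsum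
  refine key.trans (mul_le_mul_of_nonneg_left (measureReal_mono ?_ (measure_ne_top _ _))
    (by positivity))
  refine Set.iUnion₂_subset fun q hq => ?_
  obtain ⟨k, hk, hqk⟩ := Finset.mem_biUnion.1 hq
  rw [hA k q hqk]
  refine Set.subset_iUnion₂_of_subset k ((Nat.le_add_right _ _).trans (Finset.mem_Ico.1 hk).1) ?_
  exact Set.subset_biUnion_of_mem (u := fun q => matSet M K β q (ρ k)) hqk

/-- The systems lying in infinitely many of the `matSet`s have positive measure. -/
theorem volume_setOf_frequently_matSet_pos (hM : 0 < M) (hK : K = 16 * M ^ 2)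
    (hβ : ∀ i, M • β i = 0) (w : ι → ℕ) (hρ : ∀ k, 0 ≤ ρ k) (hρ' : ∀ k, ρ k ≤ 1 / 2)
    (hdiv : ¬ Summable fun k => ((2 : ℝ) ^ k) ^ Fintype.card ι * ρ k ^ Fintype.card κ) :
    0 < volume {ξ : κ → ι → UnitAddCircle |
      ∃ᶠ k in Filter.atTop, ∃ q ∈ vecBlock M K w k, ξ ∈ matSet M K β q (ρ k)} := by
  set U : ℕ → Set (κ → ι → UnitAddCircle) := fun k₀ =>
    ⋃ k ≥ k₀, ⋃ q ∈ vecBlock M K w k, matSet M K β q (ρ k)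
  have hU : {ξ : κ → ι → UnitAddCircle |
      ∃ᶠ k in Filter.atTop, ∃ q ∈ vecBlock M K w k, ξ ∈ matSet M K β q (ρ k)} = ⋂ k₀, U k₀ := by
    ext ξ
    simp [U, Filter.frequently_atTop]
  have hUm : ∀ k₀, MeasurableSet (U k₀) := fun k₀ =>
    MeasurableSet.biUnion (Set.to_countable _) fun k _ =>
      Finset.measurableSet_biUnion _ fun q _ => measurableSet_matSet _ _ _ _ _
  have hanti : Antitone U := fun a b hab =>
    Set.biUnion_subset_biUnion_left fun k (hk : k ≥ b) => hab.trans hk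
  have hlim := tendsto_measure_iInter_atTop (μ := volume)
    (fun k => (hUm k).nullMeasurableSet) hanti ⟨0, measure_ne_top _ _⟩
  set C : ℝ := (8 * M ^ 2 : ℝ) ^ Fintype.card κ + 1
  have hC : 0 < C := by positivity
  have hle : ∀ k, ENNReal.ofReal (1 / C) ≤ volume (U k) := fun k => by
    rw [ENNReal.ofReal_le_iff_le_toReal (measure_ne_top _ _), div_le_iff₀ hC, mul_comm]
    exact one_le_mul_volume_real_iUnion_matSet hM hK hβ w hρ hρ' hdiv k
  rw [hU]
  exact (ENNReal.ofReal_pos.2 (by positivity)).trans_le (ge_of_tendsto' hlim hle)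

end LimsupTorus

open scoped Pointwise in
/-- A zero–one law: a measurable set of matrices which is invariant under integer translations and
under multiplication by the integers congruent to `1` modulo `M` is null or conull. -/
theorem measure_eq_zero_or_compl_of_periodic {κ ι : Type*} [Fintype κ] [Fintype ι] {M : ℕ}
    (hM : 0 < M) {E : Set (κ → ι → ℝ)} (hE : MeasurableSet E)
    (hper : ∀ x ∈ E, ∀ z : κ → ι → ℤ, (fun i j => x i j + z i j) ∈ E)
    (hscale : ∀ x ∈ E, ∀ l : ℕ, ((l * M + 1 : ℕ) : ℝ) • x ∈ E) :
    volume E = 0 ∨ volume Eᶜ = 0 := by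
  refine or_iff_not_imp_left.2 fun hE0 => ?_
  let T : (κ → ι → ℤ) → (κ → ι → ℝ) := fun z i j => z i j
  have hperD : ∀ x ∈ Eᶜ, ∀ z, x + T z ∈ Eᶜ := by
    intro x hx z hxz
    refine hx ?_
    have := hper _ hxz (-z)
    simpa [T] using this
  have hfreq : ∃ᵐ x : κ → ι → ℝ, x ∈ E := frequently_ae_mem_iff.2 hE0
  obtain ⟨x, hxE, hx⟩ := (hfreq.and_eventually
    (Besicovitch.ae_tendsto_measure_inter_div_of_measurableSet volume hE.compl)).exists
  rw [Set.indicator_of_notMem (by simpa using hxE)] at hx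
  have hr : Filter.Tendsto (fun l : ℕ => (((l * M + 1 : ℕ) : ℝ))⁻¹) Filter.atTop
      (nhdsWithin 0 (Set.Ioi 0)) := by
    refine tendsto_inv_atTop_nhdsGT_zero.comp (tendsto_natCast_atTop_atTop.comp ?_)
    exact Filter.tendsto_atTop_mono (fun l => (Nat.le_mul_of_pos_right l hM).trans
      (Nat.le_succ _)) Filter.tendsto_id
  let Q : Set (κ → ι → ℝ) := {y | ∀ i j, 0 ≤ y i j ∧ y i j < 1}
  have hQ : volume (Eᶜ ∩ Q) = 0 := by
    have hlim := ENNReal.Tendsto.mul_const (b := volume (Metric.closedBall (0 : κ → ι → ℝ) 1))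
      (hx.comp hr) (Or.inr measure_closedBall_lt_top.ne)
    rw [zero_mul] at hlim
    refine le_antisymm (ge_of_tendsto' hlim fun l => ?_) zero_le
    set a : ℝ := ((l * M + 1 : ℕ) : ℝ)
    have ha : 0 < a := by positivity
    have h1 : volume (Eᶜ ∩ Q) ≤ volume (Eᶜ ∩ Metric.closedBall (a • x) 1) := by
      rw [← measure_preimage_add_right volume (T fun i j => ⌊a * x i j⌋)
        (Eᶜ ∩ Metric.closedBall _ _)]
      refine measure_mono fun y hy => ⟨hperD y hy.1 _, ?_⟩
      rw [Metric.mem_closedBall, dist_pi_le_iff zero_le_one]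
      refine fun i => (dist_pi_le_iff zero_le_one).2 fun j => ?_
      have h2 := hy.2 i j
      have h3 := Int.floor_le (a * x i j)
      have h4 := Int.lt_floor_add_one (a * x i j)
      simp only [Pi.add_apply, Pi.smul_apply, smul_eq_mul, T, Real.dist_eq]
      rw [abs_le]
      constructor <;> linarith
    have hball : a • Metric.closedBall x a⁻¹ = Metric.closedBall (a • x) 1 := by
      rw [smul_closedBall' ha.ne', Real.norm_of_nonneg ha.le, mul_inv_cancel₀ ha.ne']
    have h2 : Eᶜ ∩ Metric.closedBall (a • x) 1 ⊆ a • (Eᶜ ∩ Metric.closedBall x a⁻¹) := by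
      rw [Set.smul_set_inter₀ ha.ne', hball]
      refine Set.inter_subset_inter_left _ fun y hy => ?_
      rw [Set.mem_smul_set_iff_inv_smul_mem₀ ha.ne']
      intro h
      refine hy ?_
      have := hscale _ h l
      rwa [smul_inv_smul₀ ha.ne'] at this
    have hpos : volume (Metric.closedBall x a⁻¹) ≠ 0 :=
      (Metric.measure_closedBall_pos _ _ (by positivity)).ne'
    calc volume (Eᶜ ∩ Q) ≤ volume (a • (Eᶜ ∩ Metric.closedBall x a⁻¹)) :=
          h1.trans (measure_mono h2)
      _ = volume (Eᶜ ∩ Metric.closedBall x a⁻¹) / volume (Metric.closedBall x a⁻¹) *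
            volume (a • Metric.closedBall x a⁻¹) := by
          rw [Measure.addHaar_smul, Measure.addHaar_smul, mul_left_comm,
            ENNReal.div_mul_cancel hpos measure_closedBall_lt_top.ne]
      _ = _ := by
          rw [hball, Measure.addHaar_closedBall_center volume (a • x)]
          rfl
  have hcover : Eᶜ ⊆ ⋃ z, (fun y => y + T z) ⁻¹' (Eᶜ ∩ Q) := by
    intro y hy
    refine Set.mem_iUnion.2 ⟨fun i j => -⌊y i j⌋, hperD _ hy _, fun i j => ?_⟩
    have h3 := Int.floor_le (y i j)
    have h4 := Int.lt_floor_add_one (y i j)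
    simp only [Pi.add_apply, T]
    push_cast
    constructor <;> linarith
  refine measure_mono_null hcover (measure_iUnion_null fun z => ?_)
  rw [measure_preimage_add_right, hQ]

theorem measurableSet_setOf_frequently_mem {X : Type*} [MeasurableSpace X] {s : ℕ → Set X}
    (hs : ∀ k, MeasurableSet (s k)) :
    MeasurableSet {x | ∃ᶠ k in Filter.atTop, x ∈ s k} := by
  have : {x | ∃ᶠ k in Filter.atTop, x ∈ s k} = Filter.limsup s Filter.atTop := by
    ext x
    rw [Filter.mem_limsup_iff_frequently_mem, Set.mem_ofPred_eq]
  rw [this]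
  exact .measurableSet_limsup hs

theorem measurePreserving_coe_unitAddCircle (κ ι : Type*) [Fintype κ] [Fintype ι] :
    MeasurePreserving (fun (x : κ → ι → ℝ) i j => (x i j : UnitAddCircle))
      (volume.restrict (Set.univ.pi fun _ => Set.univ.pi fun _ => Set.Ioc 0 (0 + 1))) volume := by
  have hι : MeasurePreserving (fun (x : ι → ℝ) j => (x j : UnitAddCircle))
      (volume.restrict (Set.univ.pi fun _ => Set.Ioc 0 (0 + 1))) volume := by
    rw [volume_pi, volume_pi, Measure.restrict_pi_pi]
    exact measurePreserving_pi (fun _ => volume.restrict (Set.Ioc (0 : ℝ) (0 + 1)))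
      (fun _ => volume) fun _ => UnitAddCircle.measurePreserving_mk 0
  rw [volume_pi, volume_pi, Measure.restrict_pi_pi]
  exact measurePreserving_pi
    (fun _ => volume.restrict (Set.univ.pi fun _ : ι => Set.Ioc (0 : ℝ) (0 + 1)))
    (fun _ => volume) fun _ => hι

/-- The matrices `ξ` such that `ξ q + u / M` is an integer vector for some `q ∈ B`. -/
def latticeSet {κ ι : Type*} [Fintype ι] (M : ℕ) (u : κ → ℤ) (B : Finset (ι → ℕ)) :
    Set (κ → ι → ℝ) :=
  {ξ | ∃ q ∈ B, ∃ s : κ → ℤ, ∀ i, ∑ j, ξ i j * q j + s i + u i / M = 0}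

/-- The matrices lying infinitely often within distance `r k` of the `k`-th `latticeSet`. -/
def limsupThickening {κ ι : Type*} [Fintype κ] [Fintype ι] (M : ℕ) (u : κ → ℤ)
    (B : ℕ → Finset (ι → ℕ)) (r : ℕ → ℝ) : Set (κ → ι → ℝ) :=
  {ξ | ∃ᶠ k in Filter.atTop, ξ ∈ Metric.thickening (r k) (latticeSet M u (B k))}

section limsupThickening

variable {κ ι : Type*} [Fintype κ] [Fintype ι] {M : ℕ} {u : κ → ℤ} {B : ℕ → Finset (ι → ℕ)}
  {r : ℕ → ℝ}

theorem measurableSet_limsupThickening : MeasurableSet (limsupThickening M u B r) :=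
  measurableSet_setOf_frequently_mem fun _ => Metric.isOpen_thickening.measurableSet

theorem limsupThickening_mul_ae_eq (hr : Filter.Tendsto r Filter.atTop (nhds 0)) {c : ℝ}
    (hc : 0 < c) :
    limsupThickening M u B (fun k => c * r k) =ᵐ[volume] limsupThickening M u B r := by
  have key := blimsup_thickening_mul_ae_eq volume (fun _ => True)
    (fun k => latticeSet M u (B k)) hc r hr
  have h : ∀ r' : ℕ → ℝ, limsupThickening M u B r' =
      Filter.limsup (fun k => Metric.thickening (r' k) (latticeSet M u (B k))) Filter.atTop := by
    intro r'
    ext x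
    rw [Filter.mem_limsup_iff_frequently_mem]
    rfl
  rwa [Filter.blimsup_true, Filter.blimsup_true, ← h, ← h] at key

theorem add_mem_limsupThickening {x : κ → ι → ℝ} (hx : x ∈ limsupThickening M u B r)
    (z : κ → ι → ℤ) : (fun i j => x i j + z i j) ∈ limsupThickening M u B r := by
  refine hx.mono fun k hk => ?_
  obtain ⟨y, ⟨q, hq, s, hs⟩, hy⟩ := Metric.mem_thickening_iff.1 hk
  refine Metric.mem_thickening_iff.2 ⟨fun i j => y i j + z i j,
    ⟨q, hq, fun i => s i - ∑ j, z i j * q j, fun i => ?_⟩, ?_⟩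
  · rw [← hs i]
    push_cast
    simp only [add_mul, Finset.sum_add_distrib]
    ring
  · exact (dist_add_right x y fun i j => (z i j : ℝ)).trans_lt hy

theorem smul_mem_limsupThickening (hM : 0 < M) {x : κ → ι → ℝ}
    (hx : x ∈ limsupThickening M u B r) (l : ℕ) :
    ((l * M + 1 : ℕ) : ℝ) • x ∈ limsupThickening M u B fun k => ((l * M + 1 : ℕ) : ℝ) * r k := by
  have hM' : (M : ℝ) ≠ 0 := by exact_mod_cast hM.ne'
  refine hx.mono fun k hk => ?_
  obtain ⟨y, ⟨q, hq, s, hs⟩, hy⟩ := Metric.mem_thickening_iff.1 hk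
  refine Metric.mem_thickening_iff.2 ⟨((l * M + 1 : ℕ) : ℝ) • y,
    ⟨q, hq, fun i => (l * M + 1) * s i + l * u i, fun i => ?_⟩, ?_⟩
  · have e : ∑ j, (((l * M + 1 : ℕ) : ℝ) • y) i j * q j =
        ((l * M + 1 : ℕ) : ℝ) * ∑ j, y i j * q j := by
      rw [Finset.mul_sum]
      exact Finset.sum_congr rfl fun j _ => by simp only [Pi.smul_apply, smul_eq_mul]; ring
    have e' : ∑ j, y i j * (q j : ℝ) = - s i - u i / M := by linarith [hs i]
    rw [e, e']
    push_cast
    field_simp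
    ring
  · rw [dist_smul₀, Real.norm_of_nonneg (by positivity)]
    exact mul_lt_mul_of_pos_left hy (by positivity)

theorem volume_compl_limsupThickening (hM : 0 < M)
    (hr : Filter.Tendsto r Filter.atTop (nhds 0)) {c : ℝ} (hc : 0 < c)
    (hpos : volume (limsupThickening M u B fun k => c * r k) ≠ 0) {ε : ℝ} (hε : 0 < ε) :
    volume (limsupThickening M u B fun k => ε * r k)ᶜ = 0 := by
  set E : Set (κ → ι → ℝ) := ⋃ a : ℕ, limsupThickening M u B fun k => ((a + 1 : ℕ) : ℝ) * r k
  have hae : E =ᵐ[volume] limsupThickening M u B r := by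
    have := Filter.EventuallyEq.countable_iUnion fun a : ℕ =>
      limsupThickening_mul_ae_eq (M := M) (u := u) (B := B) hr
        (by positivity : (0 : ℝ) < ((a + 1 : ℕ) : ℝ))
    rwa [Set.iUnion_const] at this
  have h := measure_eq_zero_or_compl_of_periodic hM (E := E)
    (MeasurableSet.iUnion fun _ => measurableSet_limsupThickening)
    (fun x hx z => by
      obtain ⟨a, ha⟩ := Set.mem_iUnion.1 hx
      exact Set.mem_iUnion.2 ⟨a, add_mem_limsupThickening ha z⟩)
    (fun x hx l => by
      obtain ⟨a, ha⟩ := Set.mem_iUnion.1 hx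
      refine Set.mem_iUnion.2 ⟨(l * M + 1) * (a + 1) - 1, ?_⟩
      have e : (l * M + 1) * (a + 1) - 1 + 1 = (l * M + 1) * (a + 1) :=
        Nat.sub_add_cancel (Nat.mul_pos (Nat.succ_pos _) (Nat.succ_pos _))
      rw [e]
      simpa only [Nat.cast_mul (l * M + 1), mul_assoc] using smul_mem_limsupThickening hM ha l)
  have hc' := limsupThickening_mul_ae_eq (M := M) (u := u) (B := B) hr hc
  have hε' := limsupThickening_mul_ae_eq (M := M) (u := u) (B := B) hr hε
  rcases h with h | h
  · rw [measure_congr (hae.trans hc'.symm)] at h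
    exact absurd h hpos
  · rwa [measure_congr (hae.trans hε'.symm).compl] at h

end limsupThickening

theorem mem_thickening_latticeSet {κ ι : Type*} [Fintype κ] [Fintype ι] [DecidableEq ι]
    [Nonempty ι] {M K k : ℕ} (hM : 0 < M) {u : κ → ℤ} {w q : ι → ℕ} (hq : q ∈ vecBlock M K w k)
    {r : ℝ} (hr : 0 < r) {x : κ → ι → ℝ}
    (hx : (fun i j => (x i j : UnitAddCircle)) ∈
      matSet M K (fun i => ((u i / M : ℝ) : UnitAddCircle)) q r) :
    x ∈ Metric.thickening (2 * (r / 2 ^ k)) (latticeSet M u (vecBlock M K w k)) := by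
  obtain ⟨j₀⟩ := ‹Nonempty ι›
  set e : κ → ℝ := fun i => ∑ j, x i j * q j + u i / M - round (∑ j, x i j * q j + u i / M : ℝ)
  have hM' : (1 : ℝ) ≤ M := by exact_mod_cast hM
  have he : ∀ i, |e i| ≤ r := fun i => by
    have h := (hx i (Set.mem_univ i)).1
    have e1 : torusForm q (fun j => (x i j : UnitAddCircle)) + ((u i / M : ℝ) : UnitAddCircle) =
        ((∑ j, x i j * q j + u i / M : ℝ) : UnitAddCircle) := by
      rw [torusForm_apply, AddCircle.coe_add]
      congr 1
      rw [← QuotientAddGroup.mk'_apply, map_sum]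
      refine Finset.sum_congr rfl fun j _ => ?_
      rw [mul_comm, ← nsmul_eq_mul, map_nsmul]
      rfl
    rw [e1, UnitAddCircle.norm_eq] at h
    exact h.trans (div_le_self hr.le hM')
  have hq0 : (2 ^ k : ℝ) ≤ q j₀ := by exact_mod_cast le_of_mem_vecBlock hq j₀
  have h2k : (0 : ℝ) < 2 ^ k := by positivity
  have hq0' : (q j₀ : ℝ) ≠ 0 := (h2k.trans_le hq0).ne'
  refine Metric.mem_thickening_iff.2 ⟨fun i => x i - Pi.single j₀ (e i / q j₀),
    ⟨q, hq, fun i => - round (∑ j, x i j * q j + u i / M : ℝ), fun i => ?_⟩, ?_⟩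
  · have e1 : ∑ j, (x i - Pi.single j₀ (e i / q j₀) : ι → ℝ) j * (q j : ℝ) =
      ∑ j, x i j * q j - e i := by
      simp only [Pi.sub_apply, sub_mul, Finset.sum_sub_distrib]
      congr 1
      rw [Finset.sum_eq_single j₀ (fun j _ hj => by rw [Pi.single_eq_of_ne hj, zero_mul])
        (fun h => absurd (Finset.mem_univ _) h), Pi.single_eq_same, div_mul_cancel₀ _ hq0']
    rw [e1]
    push_cast
    simp only [e]
    ring
  · have hδ : 0 < r / 2 ^ k := by positivity
    refine lt_of_le_of_lt ?_ (by linarith : r / 2 ^ k < 2 * (r / 2 ^ k))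
    refine (dist_pi_le_iff hδ.le).2 fun i => ?_
    rw [dist_eq_norm, sub_sub_cancel, Pi.norm_single, norm_div, Real.norm_eq_abs, Real.norm_natCast]
    gcongr
    exact he i

/-- Almost every matrix lies infinitely often within distance `ε ρ k / 2 ^ k` of the `k`-th
`latticeSet`. -/
theorem volume_compl_limsupThickening_vecBlock {κ ι : Type*} [Fintype κ] [Fintype ι]
    [DecidableEq ι] [Nonempty ι] {M : ℕ} (hM : 0 < M) (u : κ → ℤ) (w : ι → ℕ) {ρ : ℕ → ℝ}
    (hρ : ∀ k, 0 < ρ k) (hρ' : ∀ k, ρ k ≤ 1 / 2)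
    (hdiv : ¬ Summable fun k => ((2 : ℝ) ^ k) ^ Fintype.card ι * ρ k ^ Fintype.card κ)
    {ε : ℝ} (hε : 0 < ε) :
    volume (limsupThickening M u (vecBlock M (16 * M ^ 2) w) fun k => ε * (ρ k / 2 ^ k))ᶜ = 0 := by
  have hM' : (M : ℝ) ≠ 0 := by exact_mod_cast hM.ne'
  set β : κ → UnitAddCircle := fun i => ((u i / M : ℝ) : UnitAddCircle) with hβ_def
  have hβ : ∀ i, M • β i = 0 := fun i => by
    rw [hβ_def, ← AddCircle.coe_nsmul, nsmul_eq_mul, mul_div_cancel₀ _ hM',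
      AddCircle.coe_eq_zero_iff]
    exact ⟨u i, by simp⟩
  have hF := volume_setOf_frequently_matSet_pos hM rfl hβ w (fun k => (hρ k).le) hρ' hdiv
  set F := {ξ : κ → ι → UnitAddCircle | ∃ᶠ k in Filter.atTop,
    ∃ q ∈ vecBlock M (16 * M ^ 2) w k, ξ ∈ matSet M (16 * M ^ 2) β q (ρ k)}
  have hFm : MeasurableSet F := by
    have := measurableSet_setOf_frequently_mem
      (s := fun k => ⋃ q ∈ vecBlock M (16 * M ^ 2) w k, matSet M (16 * M ^ 2) β q (ρ k))
      fun k => Finset.measurableSet_biUnion _ fun q _ => measurableSet_matSet _ _ _ _ _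
    simpa only [Set.mem_iUnion₂, exists_prop] using this
  have hr : Filter.Tendsto (fun k => ρ k / 2 ^ k) Filter.atTop (nhds 0) := by
    refine squeeze_zero (fun k => by have := hρ k; positivity)
      (fun k => ?_) (tendsto_pow_atTop_nhds_zero_of_lt_one (r := (1 / 2 : ℝ)) (by norm_num)
      (by norm_num))
    rw [div_pow, one_pow]
    have := hρ' k
    gcongr
    linarith
  refine volume_compl_limsupThickening hM hr two_pos (fun h0 => hF.ne' ?_) hε
  rw [← (measurePreserving_coe_unitAddCircle κ ι).measure_preimage hFm.nullMeasurableSet]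
  refine measure_mono_null (fun x hx => ?_) (Measure.restrict_le_self.absolutelyContinuous h0)
  refine Filter.Frequently.mono hx fun k hk => ?_
  obtain ⟨q, hq, hxq⟩ := hk
  exact mem_thickening_latticeSet hM hq (hρ k) hxq

theorem not_summable_min {f : ℕ → ℝ} (hf : ¬ Summable f) {c : ℝ} (hc : 0 < c) :
    ¬ Summable fun k => min (f k) c := by
  refine fun h => hf ((summable_congr_atTop ?_).1 h)
  filter_upwards [h.tendsto_atTop_zero.eventually_lt_const hc] with k hk
  exact min_eq_left ((min_lt_iff.1 hk).resolve_right (lt_irrefl c)).le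

theorem not_summable_two_pow_mul {f : ℕ → ℝ} (h0 : ∀ k, 0 ≤ f k) (hf : Antitone f)
    (hdiv : ¬ Summable f) {n : ℕ} (hn : 0 < n) :
    ¬ Summable fun k => ((2 : ℝ) ^ k) ^ n * f ((2 ^ (k + 1)) ^ n) := by
  intro h
  refine hdiv ((summable_schlomilch_iff_of_nonneg (C := 2 ^ n) (u := fun k => (2 ^ k) ^ n) h0
    (fun _ _ _ hab => hf hab) (fun k => by positivity) ?_ (by positivity) ?_).1 ?_)
  · exact fun a b hab => Nat.pow_lt_pow_left (Nat.pow_lt_pow_right (by norm_num) hab) hn.ne'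
  · intro k
    refine le_of_eq ?_
    simp only [smul_eq_mul, Nat.mul_sub, ← mul_pow, ← pow_succ']
  · rw [← summable_nat_add_iff 1]
    refine (h.mul_left ((2 ^ n - 1) * 2 ^ n)).congr fun k => ?_
    push_cast
    simp only [pow_succ, mul_pow]
    ring

theorem norm_sum_mul_add_le {ι : Type*} [Fintype ι] {k : ℕ} {q : ι → ℕ}
    (hq : ∀ j, q j ≤ 2 ^ (k + 1)) {x y : ι → ℝ} {δ : ℝ} (hxy : dist x y ≤ δ) {t : ℝ}
    (ht : ∑ j, y j * q j + t = 0) :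
    |∑ j, x j * q j + t| ≤ Fintype.card ι * (δ * 2 ^ (k + 1)) := by
  have hδ : 0 ≤ δ := dist_nonneg.trans hxy
  have e : ∑ j, x j * q j + t = ∑ j, (x j - y j) * q j := by
    simp only [sub_mul, Finset.sum_sub_distrib]
    linarith
  rw [e, ← nsmul_eq_mul, ← Finset.card_univ]
  refine (Finset.abs_sum_le_sum_abs _ _).trans (Finset.sum_le_card_nsmul _ _ _ fun j _ => ?_)
  rw [abs_mul, Nat.abs_cast]
  have h1 : |x j - y j| ≤ δ := (dist_le_pi_dist x y j).trans hxy
  have h2 : (q j : ℝ) ≤ 2 ^ (k + 1) := by exact_mod_cast hq j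
  gcongr

/-- **Khinchin–Groshev theorem with congruence conditions.**
If `ψ : ℕ → (0,∞)` is non-increasing with `∑ ψ(k) = ∞`, `N ∈ ℕ^d`, `v ∈ ℤ^d`
(where `d = m + n`), then for Lebesgue-almost every real `m × n` matrix `θ`
there are infinitely many pairs `(p, q) ∈ ℤ^m × ℤ^n` with
`‖θ q + p‖ ^ m ≤ ψ (‖q‖ ^ n)`, `p j ≡ v j (mod N j)` for `1 ≤ j ≤ m` and
`q j ≡ v (m + j) (mod N (m + j))` for `1 ≤ j ≤ n`. -/
theorem khinchin_groshev_congruence (m n : ℕ) (hm : 0 < m) (hn : 0 < n)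
    (ψ : ℕ → ℝ) (hψpos : ∀ k, 0 < ψ k) (hψanti : Antitone ψ)
    (N : Fin (m + n) → ℕ) (hN : ∀ j, 0 < N j) (v : Fin (m + n) → ℤ)
    (hdiv : ¬ Summable ψ) :
    ∀ᵐ θ : Fin m → Fin n → ℝ,
      {pq : (Fin m → ℤ) × (Fin n → ℤ) |
        ‖(fun i => ∑ j, θ i j * (pq.2 j : ℝ) + (pq.1 i : ℝ))‖ ^ m ≤
          ψ ((Finset.univ.sup fun j => (pq.2 j).natAbs) ^ n) ∧
        (∀ j : Fin m, pq.1 j ≡ v (Fin.castAdd n j) [ZMOD (N (Fin.castAdd n j))]) ∧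
        (∀ j : Fin n, pq.2 j ≡ v (Fin.natAdd m j) [ZMOD (N (Fin.natAdd m j))])}.Infinite := by
  have : Nonempty (Fin n) := ⟨⟨0, hn⟩⟩
  set M : ℕ := ∏ j, N j
  have hM : 0 < M := Finset.prod_pos fun j _ => hN j
  have hM' : (0 : ℝ) < M := by exact_mod_cast hM
  have hn' : (0 : ℝ) < n := by exact_mod_cast hn
  have hNM : ∀ j, (N j : ℤ) ∣ M := fun j =>
    Int.natCast_dvd_natCast.2 (Finset.dvd_prod_of_mem N (Finset.mem_univ j))
  set u : Fin m → ℤ := fun i => v (Fin.castAdd n i)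
  set w : Fin n → ℕ := fun j => (v (Fin.natAdd m j) % M).toNat
  have hw : ∀ j, (w j : ℤ) = v (Fin.natAdd m j) % M := fun j =>
    Int.toNat_of_nonneg (Int.emod_nonneg _ (by exact_mod_cast hM.ne'))
  set f : ℕ → ℝ := fun k => min (ψ k) ((1 / 2) ^ m)
  have hf0 : ∀ k, 0 < f k := fun k => lt_min (hψpos k) (by positivity)
  have hf : Antitone f := fun a b hab => min_le_min_right _ (hψanti hab)
  have hfdiv : ¬ Summable f := not_summable_min hdiv (by positivity)
  set ρ : ℕ → ℝ := fun k => f ((2 ^ (k + 1)) ^ n) ^ ((m : ℝ)⁻¹)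
  have hρpow : ∀ k, ρ k ^ m = f ((2 ^ (k + 1)) ^ n) := fun k =>
    Real.rpow_inv_natCast_pow (hf0 _).le hm.ne'
  have hρ : ∀ k, 0 < ρ k := fun k => Real.rpow_pos_of_pos (hf0 _) _
  have hρ' : ∀ k, ρ k ≤ 1 / 2 := fun k => by
    rw [← pow_le_pow_iff_left₀ (hρ k).le (by norm_num) hm.ne', hρpow]
    exact min_le_right _ _
  have hρdiv : ¬ Summable fun k => ((2 : ℝ) ^ k) ^ Fintype.card (Fin n) *
      ρ k ^ Fintype.card (Fin m) := by
    simp only [Fintype.card_fin, hρpow]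
    exact not_summable_two_pow_mul (fun k => (hf0 k).le) hf hfdiv hn
  have hnull := volume_compl_limsupThickening_vecBlock hM u w hρ hρ' hρdiv
    (ε := 1 / (2 * n * M)) (by positivity)
  set G := limsupThickening M u (vecBlock M (16 * M ^ 2) w)
    fun k => 1 / (2 * n * M) * (ρ k / 2 ^ k)
  have hnull' : volume ((fun θ : Fin m → Fin n → ℝ => (M : ℝ)⁻¹ • θ) ⁻¹' Gᶜ) = 0 := by
    rw [Measure.addHaar_preimage_smul _ (by positivity), hnull, mul_zero]
  filter_upwards [measure_eq_zero_iff_ae_notMem.1 hnull'] with θ hθ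
  have hθ : (M : ℝ)⁻¹ • θ ∈ G := by simpa using hθ
  let j₀ : Fin n := ⟨0, hn⟩
  refine Set.Infinite.of_image
    (fun pq : (Fin m → ℤ) × (Fin n → ℤ) => Nat.log 2 (pq.2 j₀).natAbs) ?_
  refine (Nat.frequently_atTop_iff_infinite.1 hθ).mono fun k hk => ?_
  obtain ⟨y, ⟨q, hq, s, hs⟩, hy⟩ := Metric.mem_thickening_iff.1 hk
  refine ⟨(fun i => u i + M * s i, fun j => q j), ⟨?_, fun i => ?_, fun j => ?_⟩,
    by simpa using log_of_mem_vecBlock hq j₀⟩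
  · have hle : ‖(fun i => ∑ j, θ i j * ((q j : ℤ) : ℝ) + ((u i + M * s i : ℤ) : ℝ))‖ ≤ ρ k := by
      refine (pi_norm_le_iff_of_nonneg (hρ k).le).2 fun i => ?_
      have h1 := norm_sum_mul_add_le (fun j => (lt_of_mem_vecBlock hq j).le)
        ((dist_le_pi_dist _ _ i).trans hy.le) (by rw [← add_assoc]; exact hs i)
      have h2 : ∑ j, θ i j * ((q j : ℤ) : ℝ) + ((u i + M * s i : ℤ) : ℝ) =
          M * (∑ j, ((M : ℝ)⁻¹ • θ) i j * q j + (s i + u i / M)) := by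
        rw [mul_add, Finset.mul_sum]
        congr 1
        · refine Finset.sum_congr rfl fun j _ => ?_
          simp only [Pi.smul_apply, smul_eq_mul, Int.cast_natCast]
          field_simp
        · push_cast
          field_simp
          ring
      rw [h2, Real.norm_eq_abs, abs_mul, Nat.abs_cast]
      calc _ ≤ (M : ℝ) * _ := mul_le_mul_of_nonneg_left h1 hM'.le
        _ = ρ k := by
          rw [Fintype.card_fin, pow_succ]
          field_simp
    have hsup : (Finset.univ.sup fun j => ((q j : ℤ)).natAbs) ≤ 2 ^ (k + 1) :=
      Finset.sup_le fun j _ => by simpa using (lt_of_mem_vecBlock hq j).le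
    calc _ ≤ ρ k ^ m := pow_le_pow_left₀ (norm_nonneg _) hle m
      _ ≤ ψ ((2 ^ (k + 1)) ^ n) := by
        rw [hρpow]
        exact min_le_left _ _
      _ ≤ _ := hψanti (Nat.pow_le_pow_left hsup n)
  · refine (Int.modEq_iff_dvd.2 ?_).symm
    simpa [u] using (hNM _).mul_right (s i)
  · have h1 : (q j : ℤ) ≡ w j [ZMOD M] := (Int.natCast_modEq_iff).2 (modEq_of_mem_vecBlock hq j)
    have h2 : (w j : ℤ) ≡ v (Fin.natAdd m j) [ZMOD M] := by
      rw [hw]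
      exact Int.mod_modEq _ _
    exact (h1.trans h2).of_dvd (hNM _)
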